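/- arXiv:1209.5584 — 5 statements merged into one kernel-verified Lean document; each statement's English description precedes it below -/
import Mathlib

section
/- Let n ≥ 1, let M : ℝ^{n×n} → ℝ^{n×n} be a linear map and γ > 0. Assume the rank-one positivity condition: |a|²|b|² ≤ γ ⟨M(a⊗b) : a⊗b⟩ for all a, b ∈ ℝⁿ. Then for every smooth compactly supported vector field ζ : ℝⁿ → ℝⁿ one has the Korn-type inequality ∫_{ℝⁿ} |∇ζ(x)|² dx ≤ γ ∫_{ℝⁿ} ⟨M(∇ζ(x)) : ∇ζ(x)⟩ dx. -/
open Matrix MeasureTheory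

/-- The Jacobian matrix of a vector field `ζ : ℝⁿ → ℝⁿ`: `(jac ζ x) i j = ∂ζ_i/∂x_j (x)`. -/
noncomputable def jac {n : ℕ} (ζ : (Fin n → ℝ) → (Fin n → ℝ)) (x : Fin n → ℝ) :
    Matrix (Fin n) (Fin n) ℝ :=
  Matrix.of fun i j => fderiv ℝ ζ x (Pi.single j 1) i

/-- The Frobenius inner product `⟨A : B⟩ = tr(Aᵀ B)`. -/
noncomputable def mip {n : ℕ} (A B : Matrix (Fin n) (Fin n) ℝ) : ℝ :=
  (Aᵀ * B).trace

open scoped SchwartzMap FourierTransform LineDeriv ContDiff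

theorem fourier_lineDerivOp_apply {V E : Type*} [NormedAddCommGroup V] [InnerProductSpace ℝ V]
    [FiniteDimensional ℝ V] [MeasurableSpace V] [BorelSpace V]
    [NormedAddCommGroup E] [NormedSpace ℂ E] (f : 𝓢(V, E)) (m ξ : V) :
    𝓕 (∂_{m} f) ξ = (2 * Real.pi * Complex.I) • (inner ℝ ξ m : ℝ) • 𝓕 f ξ := by
  have h : (fun x : V => inner ℝ x m).HasTemperateGrowth :=
    ((innerSL ℝ).flip m).hasTemperateGrowth
  rw [SchwartzMap.fourier_lineDerivOp_eq]
  simp [SchwartzMap.smulLeftCLM_apply_apply h]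

theorem SchwartzMap.integrable_inner {V : Type*} [NormedAddCommGroup V] [InnerProductSpace ℝ V]
    [FiniteDimensional ℝ V] [MeasurableSpace V] [BorelSpace V] (f g : 𝓢(V, ℂ)) :
    Integrable fun x => inner ℂ (f x) (g x) := by
  refine (L2.integrable_inner (𝕜 := ℂ) (f.toLp 2) (g.toLp 2)).congr ?_
  filter_upwards [f.coeFn_toLp 2, g.coeFn_toLp 2] with x hf hg
  rw [hf, hg]

theorem integral_sum_sum_sum_sum {α ι : Type*} [Fintype ι] [MeasurableSpace α] {μ : Measure α}
    {f : ι → ι → ι → ι → α → ℝ} (hf : ∀ i j k l, Integrable (f i j k l) μ) :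
    ∫ x, ∑ i, ∑ j, ∑ k, ∑ l, f i j k l x ∂μ = ∑ i, ∑ j, ∑ k, ∑ l, ∫ x, f i j k l x ∂μ := by
  rw [integral_finsetSum _ fun i _ => integrable_finsetSum _ fun j _ =>
    integrable_finsetSum _ fun k _ => integrable_finsetSum _ fun l _ => hf i j k l]
  refine Finset.sum_congr rfl fun i _ => ?_
  rw [integral_finsetSum _ fun j _ =>
    integrable_finsetSum _ fun k _ => integrable_finsetSum _ fun l _ => hf i j k l]
  refine Finset.sum_congr rfl fun j _ => ?_
  rw [integral_finsetSum _ fun k _ => integrable_finsetSum _ fun l _ => hf i j k l]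
  refine Finset.sum_congr rfl fun k _ => ?_
  rw [integral_finsetSum _ fun l _ => hf i j k l]

/-- A quadratic form in the gradient which is nonnegative on rank-one matrices has nonnegative
integral. -/
theorem integral_quadratic_lineDeriv_nonneg {n : ℕ}
    (c : Fin n → Fin n → Fin n → Fin n → ℝ)
    (hc : ∀ a b : Fin n → ℝ, 0 ≤ ∑ i, ∑ j, ∑ k, ∑ l, c i j k l * ((a i * b j) * (a k * b l)))
    (F : Fin n → 𝓢(EuclideanSpace ℝ (Fin n), ℂ)) (e : Fin n → EuclideanSpace ℝ (Fin n)) :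
    0 ≤ ∫ x, ∑ i, ∑ j, ∑ k, ∑ l, c i j k l *
      (inner ℂ (∂_{e j} (F i) x) (∂_{e l} (F k) x)).re := by
  have hint (f g : 𝓢(EuclideanSpace ℝ (Fin n), ℂ)) (r : ℝ) :
      Integrable fun x => r * (inner ℂ (f x) (g x)).re :=
    (SchwartzMap.integrable_inner f g).re.const_mul r
  have hplancherel (f g : 𝓢(EuclideanSpace ℝ (Fin n), ℂ)) (r : ℝ) :
      ∫ x, r * (inner ℂ (f x) (g x)).re = ∫ ξ, r * (inner ℂ (𝓕 f ξ) (𝓕 g ξ)).re := by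
    rw [integral_const_mul, integral_const_mul]
    congr 1
    refine (integral_re (SchwartzMap.integrable_inner f g)).trans ?_
    rw [← SchwartzMap.integral_inner_fourier_fourier]
    exact (integral_re (SchwartzMap.integrable_inner (𝓕 f) (𝓕 g))).symm
  rw [integral_sum_sum_sum_sum fun i j k l => hint _ _ _]
  simp_rw [fun i j k l => hplancherel (∂_{e j} (F i)) (∂_{e l} (F k)) (c i j k l)]
  rw [← integral_sum_sum_sum_sum fun i j k l => hint _ _ _]
  refine integral_nonneg fun ξ => ?_
  have h := add_nonneg
    (hc (fun i => (𝓕 (F i) ξ).re) fun j => 2 * Real.pi * inner ℝ ξ (e j))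
    (hc (fun i => (𝓕 (F i) ξ).im) fun j => 2 * Real.pi * inner ℝ ξ (e j))
  simp only [← Finset.sum_add_distrib] at h
  refine h.trans_eq ?_
  refine Finset.sum_congr rfl fun i _ => Finset.sum_congr rfl fun j _ =>
    Finset.sum_congr rfl fun k _ => Finset.sum_congr rfl fun l _ => ?_
  rw [fourier_lineDerivOp_apply, fourier_lineDerivOp_apply]
  simp
  ring

theorem mip_eq_sum {n : ℕ} (A B : Matrix (Fin n) (Fin n) ℝ) :
    mip A B = ∑ i, ∑ j, A i j * B i j := by
  rw [mip, Matrix.trace, Finset.sum_comm]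
  simp [Matrix.mul_apply]

/-- The coefficients of the quadratic form `A ↦ ⟨M A : A⟩`. -/
theorem mip_map_eq_sum {n : ℕ}
    (M : Matrix (Fin n) (Fin n) ℝ →ₗ[ℝ] Matrix (Fin n) (Fin n) ℝ)
    (A : Matrix (Fin n) (Fin n) ℝ) :
    mip (M A) A = ∑ i, ∑ j, ∑ k, ∑ l, M (Matrix.single i j 1) k l * (A i j * A k l) := by
  have hA : M A = ∑ i, ∑ j, A i j • M (Matrix.single i j 1) := by
    conv_lhs => rw [Matrix.matrix_eq_sum_single A]
    simp_rw [map_sum, ← map_smul, Matrix.smul_single, smul_eq_mul, mul_one]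
  calc mip (M A) A = ∑ i, ∑ j, mip (A i j • M (Matrix.single i j 1)) A := by
        simp only [hA, mip, Matrix.transpose_sum, Finset.sum_mul, Matrix.trace_sum]
    _ = _ := by
        refine Finset.sum_congr rfl fun i _ => Finset.sum_congr rfl fun j _ => ?_
        rw [mip_eq_sum]
        refine Finset.sum_congr rfl fun k _ => Finset.sum_congr rfl fun l _ => ?_
        rw [Matrix.smul_apply, smul_eq_mul]
        ring

theorem continuous_jac {n : ℕ} {ζ : (Fin n → ℝ) → (Fin n → ℝ)} (hζ : ContDiff ℝ (⊤ : ℕ∞) ζ) :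
    Continuous (jac ζ) := by
  have h : Continuous (fderiv ℝ ζ) := hζ.continuous_fderiv (by simp)
  refine continuous_pi fun i => continuous_pi fun j => ?_
  exact (continuous_apply i).comp (h.clm_apply continuous_const)

theorem hasCompactSupport_jac {n : ℕ} {ζ : (Fin n → ℝ) → (Fin n → ℝ)}
    (hζc : HasCompactSupport ζ) : HasCompactSupport (jac ζ) :=
  (hζc.fderiv ℝ).comp_left (g := fun L : (Fin n → ℝ) →L[ℝ] (Fin n → ℝ) =>
    Matrix.of fun i j => L (Pi.single j 1) i) (by ext; simp)

theorem integrable_mip_map_jac {n : ℕ}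
    (M : Matrix (Fin n) (Fin n) ℝ →ₗ[ℝ] Matrix (Fin n) (Fin n) ℝ)
    {ζ : (Fin n → ℝ) → (Fin n → ℝ)} (hζ : ContDiff ℝ (⊤ : ℕ∞) ζ) (hζc : HasCompactSupport ζ) :
    Integrable fun x => mip (M (jac ζ x)) (jac ζ x) := by
  refine Continuous.integrable_of_hasCompactSupport ?_
    ((hasCompactSupport_jac hζc).comp_left (g := fun A => mip (M A) A) (by simp [mip]))
  have h := continuous_jac hζ
  simp_rw [mip_map_eq_sum]
  fun_prop

/-- The components of a test field, as complex Schwartz functions on Euclidean space. -/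
theorem exists_schwartzMap_components {n : ℕ} {ζ : (Fin n → ℝ) → (Fin n → ℝ)}
    (hζ : ContDiff ℝ (⊤ : ℕ∞) ζ) (hζc : HasCompactSupport ζ) :
    ∃ F : Fin n → 𝓢(EuclideanSpace ℝ (Fin n), ℂ), ∀ i j (x : EuclideanSpace ℝ (Fin n)),
      (∂_{EuclideanSpace.single j (1 : ℝ)} (F i) : 𝓢(EuclideanSpace ℝ (Fin n), ℂ)) x =
        (jac ζ (WithLp.ofLp x) i j : ℂ) := by
  let L := EuclideanSpace.equiv (Fin n) ℝ
  let P : Fin n → ((Fin n → ℝ) →L[ℝ] ℂ) := fun i =>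
    Complex.ofRealCLM ∘L ContinuousLinearMap.proj i
  have hs : ∀ i, ContDiff ℝ ∞ fun x => P i (ζ (L x)) := fun i =>
    (P i).contDiff.comp (hζ.comp L.contDiff)
  have hcs : ∀ i, HasCompactSupport fun x => P i (ζ (L x)) := fun i =>
    (hζc.comp_homeomorph L.toHomeomorph).comp_left (map_zero (P i))
  refine ⟨fun i => (hcs i).toSchwartzMap (hs i), fun i j x => ?_⟩
  rw [SchwartzMap.lineDerivOp_apply_eq_fderiv]
  have hd : HasFDerivAt (fun x => P i (ζ (L x)))
      (P i ∘L (fderiv ℝ ζ (L x)) ∘L (L : EuclideanSpace ℝ (Fin n) →L[ℝ] (Fin n → ℝ))) x :=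
    (P i).hasFDerivAt.comp x
      (((hζ.differentiable (by simp)) (L x)).hasFDerivAt.comp x L.hasFDerivAt)
  change fderiv ℝ (fun x => P i (ζ (L x))) x _ = _
  have he : L (EuclideanSpace.single j 1) = Pi.single j 1 := rfl
  have hx : L x = WithLp.ofLp x := rfl
  rw [hd.fderiv]
  simp [P, he, hx, jac]

theorem stmt_0 {n : ℕ} (hn : 1 ≤ n)
    (M : Matrix (Fin n) (Fin n) ℝ →ₗ[ℝ] Matrix (Fin n) (Fin n) ℝ)
    (γ : ℝ) (hγ : 0 < γ)
    (hM : ∀ a b : Fin n → ℝ,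
      (∑ i, a i ^ 2) * (∑ i, b i ^ 2) ≤ γ * mip (M (vecMulVec a b)) (vecMulVec a b))
    (ζ : (Fin n → ℝ) → (Fin n → ℝ)) (hζ : ContDiff ℝ (⊤ : ℕ∞) ζ)
    (hζc : HasCompactSupport ζ) :
    ∫ x, mip (jac ζ x) (jac ζ x) ≤ γ * ∫ x, mip (M (jac ζ x)) (jac ζ x) := by
  let N : Matrix (Fin n) (Fin n) ℝ →ₗ[ℝ] Matrix (Fin n) (Fin n) ℝ := γ • M - LinearMap.id
  have hN : ∀ A, mip (N A) A = γ * mip (M A) A - mip A A := fun A => by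
    simp [N, mip, Matrix.sub_mul]
  have hvec : ∀ a b : Fin n → ℝ,
      mip (vecMulVec a b) (vecMulVec a b) = (∑ i, a i ^ 2) * (∑ i, b i ^ 2) := fun a b => by
    rw [mip_eq_sum, Finset.sum_mul_sum]
    refine Finset.sum_congr rfl fun i _ => Finset.sum_congr rfl fun j _ => ?_
    rw [vecMulVec_apply]
    ring
  obtain ⟨F, hF⟩ := exists_schwartzMap_components hζ hζc
  have key := integral_quadratic_lineDeriv_nonneg
    (fun i j k l => N (Matrix.single i j 1) k l) (fun a b => by
      have h := mip_map_eq_sum N (vecMulVec a b)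
      simp only [vecMulVec_apply] at h
      rw [← h, hN, hvec]
      exact sub_nonneg.2 (hM a b)) F (fun j => EuclideanSpace.single j 1)
  have hpos : 0 ≤ ∫ x, mip (N (jac ζ x)) (jac ζ x) := by
    rw [← (PiLp.volume_preserving_ofLp (Fin n)).integral_comp
      (MeasurableEquiv.toLp 2 (Fin n → ℝ)).symm.measurableEmbedding]
    refine key.trans_eq (integral_congr_ae (.of_forall fun x => ?_))
    simp only [hF, mip_map_eq_sum N]
    refine Finset.sum_congr rfl fun i _ => Finset.sum_congr rfl fun j _ =>
      Finset.sum_congr rfl fun k _ => Finset.sum_congr rfl fun l _ => ?_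
    simp [mul_comm]
  have hM' := integrable_mip_map_jac M hζ hζc
  have hI := integrable_mip_map_jac LinearMap.id hζ hζc
  simp only [LinearMap.id_apply] at hI
  simp_rw [hN] at hpos
  rw [integral_sub (hM'.const_mul γ) hI, integral_const_mul] at hpos
  exact sub_nonneg.1 hpos
end

section
/- Let n ≥ 1, let M : ℝ^{n×n} → ℝ^{n×n} be a linear map and γ > 0. Assume the Korn-type inequality ∫_{ℝⁿ} |∇ζ(x)|² dx ≤ γ ∫_{ℝⁿ} ⟨M(∇ζ(x)) : ∇ζ(x)⟩ dx holds for every smooth compactly supported vector field ζ : ℝⁿ → ℝⁿ. Then the rank-one positivity condition holds: |a|²|b|² ≤ γ ⟨M(a⊗b) : a⊗b⟩ for all a, b ∈ ℝⁿ. -/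
open Matrix MeasureTheory

/-- The gradient of a scalar function, as the vector of its partial derivatives. -/
noncomputable def grad {n : ℕ} (g : (Fin n → ℝ) → ℝ) (x : Fin n → ℝ) : Fin n → ℝ :=
  fun j => fderiv ℝ g x (Pi.single j 1)

theorem continuous_grad {n : ℕ} {g : (Fin n → ℝ) → ℝ} (hg : ContDiff ℝ (⊤ : ℕ∞) g) :
    Continuous (grad g) :=
  continuous_pi fun _ => (hg.continuous_fderiv (by simp)).clm_apply continuous_const

theorem hasCompactSupport_grad {n : ℕ} {g : (Fin n → ℝ) → ℝ} (hg : HasCompactSupport g) :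
    HasCompactSupport (grad g) :=
  (hg.fderiv (𝕜 := ℝ)).comp_left
    (g := fun (L : (Fin n → ℝ) →L[ℝ] ℝ) j => L (Pi.single j 1)) (by ext; simp)

theorem jac_smul_const {n : ℕ} {g : (Fin n → ℝ) → ℝ} (hg : ContDiff ℝ (⊤ : ℕ∞) g)
    (a x : Fin n → ℝ) : jac (fun x => g x • a) x = vecMulVec a (grad g x) := by
  have hd : DifferentiableAt ℝ g x := hg.differentiable (by simp) x
  ext i j
  simp [jac, grad, vecMulVec_apply, fderiv_smul_const hd, mul_comm]

theorem grad_mul {n : ℕ} {g h : (Fin n → ℝ) → ℝ} (hg : ContDiff ℝ (⊤ : ℕ∞) g)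
    (hh : ContDiff ℝ (⊤ : ℕ∞) h) (x : Fin n → ℝ) :
    grad (fun x => g x * h x) x = h x • grad g x + g x • grad h x := by
  have hd : DifferentiableAt ℝ g x := hg.differentiable (by simp) x
  have hd' : DifferentiableAt ℝ h x := hh.differentiable (by simp) x
  ext j
  simp [grad, fderiv_fun_mul hd hd', add_comm]

theorem hasFDerivAt_const_mul_dotProduct {n : ℕ} (t : ℝ) (b x : Fin n → ℝ) :
    HasFDerivAt (fun x : Fin n → ℝ => t * (b ⬝ᵥ x))
      (t • ∑ i, b i • ContinuousLinearMap.proj (R := ℝ) (φ := fun _ : Fin n => ℝ) i) x := by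
  refine HasFDerivAt.const_mul ?_ t
  exact HasFDerivAt.fun_sum fun i _ => (hasFDerivAt_apply i x).const_mul (b i)

theorem contDiff_const_mul_dotProduct {n : ℕ} (t : ℝ) (b : Fin n → ℝ) :
    ContDiff ℝ (⊤ : ℕ∞) (fun x : Fin n → ℝ => t * (b ⬝ᵥ x)) := by
  unfold dotProduct
  fun_prop

theorem grad_cos {n : ℕ} (t : ℝ) (b x : Fin n → ℝ) :
    grad (fun x => Real.cos (t * (b ⬝ᵥ x))) x = (-(t * Real.sin (t * (b ⬝ᵥ x)))) • b := by
  ext j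
  simp [grad, (hasFDerivAt_const_mul_dotProduct t b x).cos.fderiv, Pi.single_apply]
  ring

theorem grad_sin {n : ℕ} (t : ℝ) (b x : Fin n → ℝ) :
    grad (fun x => Real.sin (t * (b ⬝ᵥ x))) x = (t * Real.cos (t * (b ⬝ᵥ x))) • b := by
  ext j
  simp [grad, (hasFDerivAt_const_mul_dotProduct t b x).sin.fderiv, Pi.single_apply]
  ring

theorem integrable_comp_grad {n : ℕ} {q : (Fin n → ℝ) → ℝ} (hq : Continuous q) (hq0 : q 0 = 0)
    {g : (Fin n → ℝ) → ℝ} (hg : ContDiff ℝ (⊤ : ℕ∞) g) (hgc : HasCompactSupport g) :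
    Integrable fun x => q (grad g x) :=
  (hq.comp (continuous_grad hg)).integrable_of_hasCompactSupport
    ((hasCompactSupport_grad hgc).comp_left hq0)

theorem bilin_grad_mul_cos_add_bilin_grad_mul_sin {n : ℕ}
    (B : (Fin n → ℝ) →ₗ[ℝ] (Fin n → ℝ) →ₗ[ℝ] ℝ) {φ : (Fin n → ℝ) → ℝ}
    (hφ : ContDiff ℝ (⊤ : ℕ∞) φ) (t : ℝ) (b x : Fin n → ℝ) :
    B (grad (fun x => φ x * Real.cos (t * (b ⬝ᵥ x))) x)
        (grad (fun x => φ x * Real.cos (t * (b ⬝ᵥ x))) x) +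
      B (grad (fun x => φ x * Real.sin (t * (b ⬝ᵥ x))) x)
        (grad (fun x => φ x * Real.sin (t * (b ⬝ᵥ x))) x) =
      B (grad φ x) (grad φ x) + t ^ 2 * B b b * φ x ^ 2 := by
  have hl := contDiff_const_mul_dotProduct t b
  rw [grad_mul hφ hl.cos, grad_mul hφ hl.sin, grad_cos, grad_sin]
  have hcs := Real.sin_sq_add_cos_sq (t * (b ⬝ᵥ x))
  simp only [map_add, map_smul, LinearMap.add_apply, LinearMap.smul_apply, smul_eq_mul]
  linear_combination (B (grad φ x) (grad φ x) + t ^ 2 * B b b * φ x ^ 2) * hcs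

theorem nonneg_of_forall_nonneg_add_sq_mul {C D : ℝ} (h : ∀ t : ℝ, 0 ≤ C + t ^ 2 * D) :
    0 ≤ D := by
  by_contra! hD
  have hC : 0 ≤ C := by simpa using h 0
  have ht := h √((C + 1) / -D)
  rw [Real.sq_sqrt (div_nonneg (by linarith) (by linarith))] at ht
  have : (C + 1) / -D * -D = C + 1 := div_mul_cancel₀ _ (by linarith)
  linarith

theorem exists_contDiff_hasCompactSupport_integral_sq_pos (n : ℕ) :
    ∃ φ : (Fin n → ℝ) → ℝ, ContDiff ℝ (⊤ : ℕ∞) φ ∧ HasCompactSupport φ ∧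
      0 < ∫ x, φ x ^ 2 := by
  let φ : ContDiffBump (0 : Fin n → ℝ) := ⟨1, 2, one_pos, one_lt_two⟩
  refine ⟨φ, φ.contDiff, φ.hasCompactSupport, ?_⟩
  refine (φ.continuous.pow 2).integral_pos_of_hasCompactSupport_nonneg_nonzero
    (φ.hasCompactSupport.comp_left (g := fun y : ℝ => y ^ 2) (by simp))
    (fun x => sq_nonneg (φ x)) (x := 0) ?_
  have h1 : φ 0 = 1 := φ.one_of_mem_closedBall (Metric.mem_closedBall_self φ.rIn_pos.le)
  simp [h1]

/-- A quadratic form whose integral over every gradient field of a test function is nonnegative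
is itself nonnegative. -/
theorem bilin_self_nonneg_of_integral_grad_nonneg {n : ℕ}
    (B : (Fin n → ℝ) →ₗ[ℝ] (Fin n → ℝ) →ₗ[ℝ] ℝ) (hB : Continuous fun v => B v v)
    (h : ∀ g : (Fin n → ℝ) → ℝ, ContDiff ℝ (⊤ : ℕ∞) g → HasCompactSupport g →
      0 ≤ ∫ x, B (grad g x) (grad g x)) (b : Fin n → ℝ) : 0 ≤ B b b := by
  obtain ⟨φ, hφ, hφc, hpos⟩ := exists_contDiff_hasCompactSupport_integral_sq_pos n
  have hsq : Integrable fun x => φ x ^ 2 := by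
    by_contra hni
    exact hpos.ne' (integral_undef hni)
  have hint {g : (Fin n → ℝ) → ℝ} (hg : ContDiff ℝ (⊤ : ℕ∞) g) (hgc : HasCompactSupport g) :
      Integrable fun x => B (grad g x) (grad g x) :=
    integrable_comp_grad (q := fun v => B v v) hB (by simp) hg hgc
  refine nonneg_of_mul_nonneg_left (nonneg_of_forall_nonneg_add_sq_mul
    (C := ∫ x, B (grad φ x) (grad φ x)) fun t => ?_) hpos
  have hl := contDiff_const_mul_dotProduct t b
  have hcos : ContDiff ℝ (⊤ : ℕ∞) fun x => φ x * Real.cos (t * (b ⬝ᵥ x)) := hφ.mul hl.cos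
  have hsin : ContDiff ℝ (⊤ : ℕ∞) fun x => φ x * Real.sin (t * (b ⬝ᵥ x)) := hφ.mul hl.sin
  have hcosc : HasCompactSupport fun x => φ x * Real.cos (t * (b ⬝ᵥ x)) := hφc.mul_right
  have hsinc : HasCompactSupport fun x => φ x * Real.sin (t * (b ⬝ᵥ x)) := hφc.mul_right
  have hadd := add_nonneg (h _ hcos hcosc) (h _ hsin hsinc)
  rw [← integral_add (hint hcos hcosc) (hint hsin hsinc)] at hadd
  simp only [bilin_grad_mul_cos_add_bilin_grad_mul_sin B hφ] at hadd
  rwa [integral_add (hint hφ hφc) (hsq.const_mul _), integral_const_mul, mul_assoc] at hadd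

/-- The Frobenius inner product as a bilinear map. -/
noncomputable def mipBilin (n : ℕ) :
    Matrix (Fin n) (Fin n) ℝ →ₗ[ℝ] Matrix (Fin n) (Fin n) ℝ →ₗ[ℝ] ℝ :=
  LinearMap.mk₂ ℝ mip (by simp [mip, add_mul]) (by simp [mip]) (by simp [mip, mul_add])
    (by simp [mip])

theorem continuous_mip_vecMulVec {n : ℕ}
    (L : Matrix (Fin n) (Fin n) ℝ →ₗ[ℝ] Matrix (Fin n) (Fin n) ℝ) (a : Fin n → ℝ) :
    Continuous fun v => mip (L (vecMulVec a v)) (vecMulVec a v) := by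
  have hv : Continuous fun v : Fin n → ℝ => vecMulVec a v :=
    continuous_const.matrix_vecMulVec continuous_id
  have hL : Continuous L := L.continuous_of_finiteDimensional
  exact ((hL.comp hv).matrix_transpose.matrix_mul hv).matrix_trace

theorem mip_vecMulVec_self {n : ℕ} (a b : Fin n → ℝ) :
    mip (vecMulVec a b) (vecMulVec a b) = (∑ i, a i ^ 2) * ∑ i, b i ^ 2 := by
  simp only [mip, trace, diag_apply, mul_apply, transpose_apply, vecMulVec_apply]
  rw [Finset.sum_comm, Finset.sum_mul_sum]
  exact Finset.sum_congr rfl fun i _ => Finset.sum_congr rfl fun j _ => by ring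

theorem stmt_1 {n : ℕ} (hn : 1 ≤ n)
    (M : Matrix (Fin n) (Fin n) ℝ →ₗ[ℝ] Matrix (Fin n) (Fin n) ℝ)
    (γ : ℝ) (hγ : 0 < γ)
    (hKorn : ∀ ζ : (Fin n → ℝ) → (Fin n → ℝ), ContDiff ℝ (⊤ : ℕ∞) ζ →
      HasCompactSupport ζ →
      ∫ x, mip (jac ζ x) (jac ζ x) ≤ γ * ∫ x, mip (M (jac ζ x)) (jac ζ x)) :
    ∀ a b : Fin n → ℝ,
      (∑ i, a i ^ 2) * (∑ i, b i ^ 2) ≤ γ * mip (M (vecMulVec a b)) (vecMulVec a b) := by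
  intro a b
  let V : (Fin n → ℝ) →ₗ[ℝ] Matrix (Fin n) (Fin n) ℝ := vecMulVecBilin ℝ ℝ a
  let B : (Fin n → ℝ) →ₗ[ℝ] (Fin n → ℝ) →ₗ[ℝ] ℝ :=
    γ • (mipBilin n).compl₁₂ (M ∘ₗ V) V - (mipBilin n).compl₁₂ V V
  have hBv (v : Fin n → ℝ) : B v v = γ * mip (M (vecMulVec a v)) (vecMulVec a v) -
      mip (vecMulVec a v) (vecMulVec a v) := rfl
  have hM := continuous_mip_vecMulVec M a
  have hid : Continuous fun v => mip (vecMulVec a v) (vecMulVec a v) :=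
    continuous_mip_vecMulVec LinearMap.id a
  have hB : Continuous fun v => B v v := by
    simp only [hBv]
    exact (hM.const_mul γ).sub hid
  have hnonneg := bilin_self_nonneg_of_integral_grad_nonneg B hB (fun g hg hgc => by
    have hK := hKorn (fun x => g x • a) (hg.smul contDiff_const) hgc.smul_right
    simp only [jac_smul_const hg] at hK
    simp only [hBv]
    rw [integral_sub ((integrable_comp_grad hM (by simp [mip]) hg hgc).const_mul γ)
      (integrable_comp_grad hid (by simp [mip]) hg hgc), integral_const_mul]
    exact sub_nonneg.2 hK) b
  rw [hBv, mip_vecMulVec_self] at hnonneg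
  exact sub_nonneg.1 hnonneg
end

section
/- Let n ≥ 1, let M : ℝ^{n×n} → ℝ^{n×n} be a linear map, γ > 0, and let U ⊂ ℝⁿ be an open, bounded, nonempty set. Then the following are equivalent: (a) ∫_U |∇ζ|² dx ≤ γ ∫_U ⟨M(∇ζ) : ∇ζ⟩ dx for every smooth vector field ζ : ℝⁿ → ℝⁿ with compact support contained in U; (b) ∫_{ℝⁿ} |∇ζ|² dx ≤ γ ∫_{ℝⁿ} ⟨M(∇ζ) : ∇ζ⟩ dx for every smooth compactly supported vector field ζ : ℝⁿ → ℝⁿ. -/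
open Matrix MeasureTheory

lemma mip_smul_smul {n : ℕ} (c : ℝ) (A B : Matrix (Fin n) (Fin n) ℝ) :
    mip (c • A) (c • B) = c ^ 2 * mip A B := by
  simp only [mip, transpose_smul, Matrix.smul_mul, Matrix.mul_smul, trace_smul, smul_eq_mul]
  ring

lemma jac_comp_smul_sub {n : ℕ} {ζ : (Fin n → ℝ) → (Fin n → ℝ)} (hζ : Differentiable ℝ ζ)
    (c : ℝ) (p x : Fin n → ℝ) :
    jac (fun y => ζ (c • (y - p))) x = c • jac ζ (c • (x - p)) := by
  have h : HasFDerivAt (fun y => ζ (c • (y - p)))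
      ((fderiv ℝ ζ (c • (x - p))).comp (c • ContinuousLinearMap.id ℝ (Fin n → ℝ))) x :=
    (hζ (c • (x - p))).hasFDerivAt.comp x (((hasFDerivAt_id x).sub_const p).const_smul c)
  ext i j
  simp [jac, h.fderiv]

lemma integral_comp_smul_sub {n : ℕ} (F : (Fin n → ℝ) → ℝ) (c : ℝ) (p : Fin n → ℝ) :
    ∫ x, F (c • (x - p)) = |(c ^ n)⁻¹| * ∫ x, F x := by
  rw [integral_sub_right_eq_self (fun x => F (c • x)) p, Measure.integral_comp_smul]
  simp

theorem stmt_2 {n : ℕ} (hn : 1 ≤ n)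
    (M : Matrix (Fin n) (Fin n) ℝ →ₗ[ℝ] Matrix (Fin n) (Fin n) ℝ)
    (γ : ℝ) (hγ : 0 < γ)
    (U : Set (Fin n → ℝ)) (hUopen : IsOpen U) (hUbdd : Bornology.IsBounded U)
    (hUne : U.Nonempty) :
    (∀ ζ : (Fin n → ℝ) → (Fin n → ℝ), ContDiff ℝ (⊤ : ℕ∞) ζ →
        HasCompactSupport ζ → tsupport ζ ⊆ U →
        ∫ x, mip (jac ζ x) (jac ζ x) ≤ γ * ∫ x, mip (M (jac ζ x)) (jac ζ x))
      ↔ (∀ ζ : (Fin n → ℝ) → (Fin n → ℝ), ContDiff ℝ (⊤ : ℕ∞) ζ →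
        HasCompactSupport ζ →
        ∫ x, mip (jac ζ x) (jac ζ x) ≤ γ * ∫ x, mip (M (jac ζ x)) (jac ζ x)) := by
  refine ⟨fun h ζ hζ hc => ?_, fun h ζ hζ hc _ => h ζ hζ hc⟩
  obtain ⟨p, hp⟩ := hUne
  obtain ⟨r, hr, hrU⟩ := Metric.nhds_basis_closedBall.mem_iff.1 (hUopen.mem_nhds hp)
  obtain ⟨R, hR, hRζ⟩ := hc.isCompact.isBounded.subset_closedBall_lt 0 0
  have hcpos : 0 < R / r := div_pos hR hr
  have hζd : Differentiable ℝ ζ := hζ.differentiable (by simp)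
  have hsupp : tsupport (fun y => ζ ((R / r) • (y - p))) ⊆ Metric.closedBall p r := by
    refine closure_minimal (fun x hx => ?_) Metric.isClosed_closedBall
    have hx' := hRζ (subset_tsupport ζ hx)
    rw [mem_closedBall_zero_iff, norm_smul, Real.norm_of_nonneg hcpos.le, div_mul_eq_mul_div,
      div_le_iff₀ hr] at hx'
    rw [mem_closedBall_iff_norm]
    exact le_of_mul_le_mul_left hx' hR
  have key := h (fun y => ζ ((R / r) • (y - p)))
    (hζ.comp ((contDiff_id.sub contDiff_const).const_smul (R / r)))
    ((isCompact_closedBall p r).of_isClosed_subset (isClosed_tsupport _) hsupp)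
    (hsupp.trans hrU)
  simp only [jac_comp_smul_sub hζd, map_smul, mip_smul_smul, integral_const_mul] at key
  rw [integral_comp_smul_sub (fun x => mip (jac ζ x) (jac ζ x)),
    integral_comp_smul_sub (fun x => mip (M (jac ζ x)) (jac ζ x))] at key
  have hk : 0 < (R / r) ^ 2 * |((R / r) ^ n)⁻¹| := by positivity
  refine le_of_mul_le_mul_left ?_ hk
  linarith
end

section
/- Let n ≥ 1, let F₀ be an invertible real n×n matrix and Q₀ a real n×n matrix such that A := sym(Q₀F₀^{-1}) is invertible. Then for every smooth compactly supported vector field ζ : ℝⁿ → ℝⁿ, writing B(x) = sym(∇ζ(x) F₀^{-1}), one has ∫_{ℝⁿ} |∇ζ(x)|² dx ≤ 2 |F₀|² |A^{-1}|² ∫_{ℝⁿ} ( 2|sym(A B(x))|² + |A B(x)|² ) dx. (This is the Korn-type inequality (1.8) for M = D_Q𝒵₁(F₀,Q₀), where 𝒵₁(F,Q) = [sym(QF^{-1})]³ F^{-1,T} and ⟨D_Q𝒵₁(F₀,Q₀)Q : Q⟩ = 2|sym(AB)|² + |AB|² with B = sym(QF₀^{-1}), with constant γ = 2|F₀|²|A^{-1}|².)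 -/
open Matrix MeasureTheory

/-- The symmetric part `sym F = (F + Fᵀ)/2`. -/
noncomputable def msym {n : ℕ} (A : Matrix (Fin n) (Fin n) ℝ) : Matrix (Fin n) (Fin n) ℝ :=
  (2 : ℝ)⁻¹ • (A + Aᵀ)

/-- Mixed directional derivatives can be exchanged under the integral. -/
theorem integral_fderiv_mul_fderiv_comm {n : ℕ} {f g : (Fin n → ℝ) → ℝ}
    (hf : ContDiff ℝ 2 f) (hg : ContDiff ℝ 2 g) (hfc : HasCompactSupport f)
    (v w : Fin n → ℝ) :
    ∫ x, fderiv ℝ f x v * fderiv ℝ g x w = ∫ x, fderiv ℝ f x w * fderiv ℝ g x v := by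
  have hf' (u : Fin n → ℝ) : Continuous fun x => fderiv ℝ f x u :=
    (hf.continuous_fderiv (by norm_num)).clm_apply continuous_const
  have hg1 (u : Fin n → ℝ) : ContDiff ℝ 1 fun x => fderiv ℝ g x u :=
    (hg.fderiv_right (m := 1) (by norm_num)).clm_apply contDiff_const
  have hg2 (u u' : Fin n → ℝ) : Continuous fun x => fderiv ℝ (fun y => fderiv ℝ g y u) x u' :=
    ((hg1 u).continuous_fderiv (by norm_num)).clm_apply continuous_const
  have by_parts (u u' : Fin n → ℝ) :
      ∫ x, f x * fderiv ℝ (fun y => fderiv ℝ g y u) x u'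
        = -∫ x, fderiv ℝ f x u' * fderiv ℝ g x u := by
    refine integral_mul_fderiv_eq_neg_fderiv_mul_of_integrable ?_ ?_ ?_
      (fun x _ => hf.differentiable (by norm_num) x)
      (fun x _ => (hg1 u).differentiable (by norm_num) x)
    · exact ((hf' u').mul (hg1 u).continuous).integrable_of_hasCompactSupport
        ((hfc.fderiv_apply (𝕜 := ℝ) u').mul_right)
    · exact (hf.continuous.mul (hg2 u u')).integrable_of_hasCompactSupport hfc.mul_right
    · exact (hf.continuous.mul (hg1 u).continuous).integrable_of_hasCompactSupport hfc.mul_right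
  have symm (x : Fin n → ℝ) : fderiv ℝ (fun y => fderiv ℝ g y w) x v
      = fderiv ℝ (fun y => fderiv ℝ g y v) x w := by
    have hd : DifferentiableAt ℝ (fderiv ℝ g) x :=
      ((hg.fderiv_right (m := 1) (by norm_num)).differentiable (by norm_num)).differentiableAt
    have h := (hg.contDiffAt (x := x)).isSymmSndFDerivAt (by simp) v w
    simpa [fderiv_clm_apply hd (differentiableAt_const _)] using h
  have h1 := by_parts w v
  have h2 := by_parts v w
  simp only [symm] at h1
  linarith

theorem mip_self {n : ℕ} (X : Matrix (Fin n) (Fin n) ℝ) : mip X X = ∑ i, ∑ j, X i j ^ 2 := by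
  simp only [mip, Matrix.trace, Matrix.diag_apply, Matrix.mul_apply, Matrix.transpose_apply, sq]
  exact Finset.sum_comm

theorem mip_self_nonneg {n : ℕ} (X : Matrix (Fin n) (Fin n) ℝ) : 0 ≤ mip X X := by
  rw [mip_self]; positivity

/-- The Frobenius norm is submultiplicative. -/
theorem mip_mul_self_le {n : ℕ} (X Y : Matrix (Fin n) (Fin n) ℝ) :
    mip (X * Y) (X * Y) ≤ mip X X * mip Y Y := by
  simp only [mip_self]
  rw [Finset.sum_comm (f := fun i j => Y i j ^ 2), Finset.sum_mul_sum]
  gcongr with i _ j _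
  rw [Matrix.mul_apply]
  exact Finset.sum_mul_sq_le_sq_mul_sq _ _ _

theorem two_mul_mip_msym_self {n : ℕ} (X : Matrix (Fin n) (Fin n) ℝ) :
    2 * mip (msym X) (msym X) = mip X X + (X * X).trace := by
  have h : (Xᵀ * Xᵀ).trace = (X * X).trace := by
    rw [← Matrix.transpose_mul, Matrix.trace_transpose]
  have h' : (X * Xᵀ).trace = (Xᵀ * X).trace := Matrix.trace_mul_comm _ _
  simp only [mip, msym, Matrix.transpose_smul, Matrix.transpose_add, Matrix.transpose_transpose,
    Matrix.smul_mul, Matrix.mul_smul, Matrix.trace_smul, Matrix.add_mul, Matrix.mul_add,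
    Matrix.trace_add, smul_eq_mul, h, h']
  ring

theorem continuous_mip_self {n : ℕ} : Continuous fun X : Matrix (Fin n) (Fin n) ℝ => mip X X := by
  unfold mip; fun_prop

theorem continuous_msym {n : ℕ} : Continuous (msym (n := n)) := by
  unfold msym; fun_prop

/-- A continuous function of the Jacobian that vanishes at `0` is integrable. -/
theorem integrable_comp_jac {n : ℕ} {ζ : (Fin n → ℝ) → (Fin n → ℝ)} (hζ : ContDiff ℝ 1 ζ)
    (hζc : HasCompactSupport ζ) {φ : Matrix (Fin n) (Fin n) ℝ → ℝ} (hφ : Continuous φ)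
    (hφ0 : φ 0 = 0) : Integrable fun x => φ (jac ζ x) := by
  have hcont : Continuous (jac ζ) := by
    refine continuous_matrix fun i j => ?_
    exact (continuous_apply i).comp
      ((hζ.continuous_fderiv (by norm_num)).clm_apply continuous_const)
  refine (hφ.comp hcont).integrable_of_hasCompactSupport ?_
  refine (hζc.fderiv (𝕜 := ℝ)).comp_left
    (g := fun L => φ (Matrix.of fun i j => L (Pi.single j 1) i)) ?_
  rw [← hφ0]
  congr 1

theorem jac_mul_apply {n : ℕ} {ζ : (Fin n → ℝ) → (Fin n → ℝ)} (hζ : Differentiable ℝ ζ)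
    (P : Matrix (Fin n) (Fin n) ℝ) (x : Fin n → ℝ) (i j : Fin n) :
    (jac ζ x * P) i j = fderiv ℝ (fun y => ζ y i) x (fun k => P k j) := by
  have h : fderiv ℝ (fun y => ζ y i) x
      = (ContinuousLinearMap.proj i).comp (fderiv ℝ ζ x) :=
    (hasFDerivAt_pi'.1 (hζ x).hasFDerivAt i).fderiv
  rw [h, pi_eq_sum_univ' fun k => P k j, map_sum, Matrix.mul_apply]
  simp [jac, mul_comm]

/-- The determinantal identity behind Korn's inequality: for `G = ∇ζ P`,
`∫ tr (G²) = ∫ (tr G)²`. -/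
theorem integral_trace_jac_mul_sq {n : ℕ} {ζ : (Fin n → ℝ) → (Fin n → ℝ)} (hζ : ContDiff ℝ 2 ζ)
    (hζc : HasCompactSupport ζ) (P : Matrix (Fin n) (Fin n) ℝ) :
    ∫ x, (jac ζ x * P * (jac ζ x * P)).trace = ∫ x, (jac ζ x * P).trace ^ 2 := by
  have hint (i j k l : Fin n) :
      Integrable fun x => (jac ζ x * P) i j * (jac ζ x * P) k l :=
    integrable_comp_jac (hζ.of_le (by norm_num)) hζc
      (φ := fun X => (X * P) i j * (X * P) k l) (by fun_prop) (by simp)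
  have hcomp (i : Fin n) : ContDiff ℝ 2 fun x => ζ x i := contDiff_pi.1 hζ i
  have hcompc (i : Fin n) : HasCompactSupport fun x => ζ x i :=
    hζc.comp_left (g := fun y : Fin n → ℝ => y i) rfl
  simp only [Matrix.trace, Matrix.diag_apply, sq, Finset.sum_mul_sum,
    Matrix.mul_apply (M := jac ζ _ * P)]
  rw [integral_finsetSum _ fun i _ => integrable_finsetSum _ fun j _ => hint _ _ _ _,
    integral_finsetSum _ fun i _ => integrable_finsetSum _ fun j _ => hint _ _ _ _]
  refine Finset.sum_congr rfl fun i _ => ?_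
  rw [integral_finsetSum _ fun j _ => hint _ _ _ _,
    integral_finsetSum _ fun j _ => hint _ _ _ _]
  refine Finset.sum_congr rfl fun j _ => ?_
  simp only [jac_mul_apply (hζ.differentiable (by norm_num))]
  exact integral_fderiv_mul_fderiv_comm (hcomp i) (hcomp j) (hcompc i) _ _

/-- Korn's first inequality for compactly supported fields and the Jacobian times a constant
matrix. -/
theorem integral_mip_jac_mul_le {n : ℕ} {ζ : (Fin n → ℝ) → (Fin n → ℝ)} (hζ : ContDiff ℝ 2 ζ)
    (hζc : HasCompactSupport ζ) (P : Matrix (Fin n) (Fin n) ℝ) :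
    ∫ x, mip (jac ζ x * P) (jac ζ x * P)
      ≤ ∫ x, 2 * mip (msym (jac ζ x * P)) (msym (jac ζ x * P)) := by
  have hζ1 : ContDiff ℝ 1 ζ := hζ.of_le (by norm_num)
  simp only [two_mul_mip_msym_self]
  rw [integral_add, integral_trace_jac_mul_sq hζ hζc]
  · exact le_add_of_nonneg_right (integral_nonneg fun x => sq_nonneg _)
  · exact integrable_comp_jac hζ1 hζc (φ := fun X => mip (X * P) (X * P))
      (continuous_mip_self.comp (by fun_prop)) (by simp [mip])
  · exact integrable_comp_jac hζ1 hζc (φ := fun X => (X * P * (X * P)).trace)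
      (by fun_prop) (by simp)

theorem stmt_6 {n : ℕ} (hn : 1 ≤ n)
    (F₀ Q₀ : Matrix (Fin n) (Fin n) ℝ) (hF₀ : IsUnit F₀.det)
    (A : Matrix (Fin n) (Fin n) ℝ) (hA : A = msym (Q₀ * F₀⁻¹)) (hAinv : IsUnit A.det)
    (ζ : (Fin n → ℝ) → (Fin n → ℝ)) (hζ : ContDiff ℝ (⊤ : ℕ∞) ζ)
    (hζc : HasCompactSupport ζ)
    (B : (Fin n → ℝ) → Matrix (Fin n) (Fin n) ℝ)
    (hB : ∀ x, B x = msym (jac ζ x * F₀⁻¹)) :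
    ∫ x, mip (jac ζ x) (jac ζ x)
      ≤ 2 * mip F₀ F₀ * mip A⁻¹ A⁻¹ *
        ∫ x, (2 * mip (msym (A * B x)) (msym (A * B x)) + mip (A * B x) (A * B x)) := by
  have hζ2 : ContDiff ℝ 2 ζ := contDiff_infty.1 hζ 2
  have hζ1 : ContDiff ℝ 1 ζ := contDiff_infty.1 hζ 1
  have hF : 0 ≤ mip F₀ F₀ := mip_self_nonneg F₀
  obtain rfl : B = fun x => msym (jac ζ x * F₀⁻¹) := funext hB
  have h_sym_int :
      Integrable fun x => 2 * mip (msym (jac ζ x * F₀⁻¹)) (msym (jac ζ x * F₀⁻¹)) :=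
    integrable_comp_jac hζ1 hζc
      (φ := fun X => 2 * mip (msym (X * F₀⁻¹)) (msym (X * F₀⁻¹)))
      (continuous_const.mul (continuous_mip_self.comp (continuous_msym.comp (by fun_prop))))
      (by simp [mip, msym])
  have h_mul_int : Integrable fun x => mip (jac ζ x * F₀⁻¹) (jac ζ x * F₀⁻¹) :=
    integrable_comp_jac hζ1 hζc (φ := fun X => mip (X * F₀⁻¹) (X * F₀⁻¹))
      (continuous_mip_self.comp (by fun_prop)) (by simp [mip])
  have h_rhs_int : Integrable fun x =>
      2 * mip (msym (A * msym (jac ζ x * F₀⁻¹))) (msym (A * msym (jac ζ x * F₀⁻¹)))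
        + mip (A * msym (jac ζ x * F₀⁻¹)) (A * msym (jac ζ x * F₀⁻¹)) := by
    have hc : Continuous fun X => A * msym (X * F₀⁻¹) :=
      continuous_const.mul (continuous_msym.comp (by fun_prop))
    exact integrable_comp_jac hζ1 hζc
      (φ := fun X => 2 * mip (msym (A * msym (X * F₀⁻¹))) (msym (A * msym (X * F₀⁻¹)))
        + mip (A * msym (X * F₀⁻¹)) (A * msym (X * F₀⁻¹)))
      ((continuous_const.mul (continuous_mip_self.comp (continuous_msym.comp hc))).add
        (continuous_mip_self.comp hc)) (by simp [mip, msym])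
  calc ∫ x, mip (jac ζ x) (jac ζ x)
      ≤ ∫ x, mip F₀ F₀ * mip (jac ζ x * F₀⁻¹) (jac ζ x * F₀⁻¹) := by
        refine integral_mono_of_nonneg (.of_forall fun x => mip_self_nonneg _)
          (h_mul_int.const_mul _) (.of_forall fun x => ?_)
        have h := mip_mul_self_le (jac ζ x * F₀⁻¹) F₀
        rwa [Matrix.nonsing_inv_mul_cancel_right F₀ _ hF₀, mul_comm] at h
    _ = mip F₀ F₀ * ∫ x, mip (jac ζ x * F₀⁻¹) (jac ζ x * F₀⁻¹) := integral_const_mul _ _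
    _ ≤ mip F₀ F₀ * ∫ x, 2 * mip (msym (jac ζ x * F₀⁻¹)) (msym (jac ζ x * F₀⁻¹)) := by
        exact mul_le_mul_of_nonneg_left (integral_mip_jac_mul_le hζ2 hζc _) hF
    _ ≤ mip F₀ F₀ * ∫ x, 2 * mip A⁻¹ A⁻¹ *
          (2 * mip (msym (A * msym (jac ζ x * F₀⁻¹))) (msym (A * msym (jac ζ x * F₀⁻¹)))
            + mip (A * msym (jac ζ x * F₀⁻¹)) (A * msym (jac ζ x * F₀⁻¹))) := by
        refine mul_le_mul_of_nonneg_left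
          (integral_mono h_sym_int (h_rhs_int.const_mul _) fun x => ?_) hF
        have h := mip_mul_self_le A⁻¹ (A * msym (jac ζ x * F₀⁻¹))
        rw [Matrix.nonsing_inv_mul_cancel_left A _ hAinv] at h
        have h' := mul_nonneg (mip_self_nonneg A⁻¹)
          (mip_self_nonneg (msym (A * msym (jac ζ x * F₀⁻¹))))
        dsimp only
        linarith
    _ = _ := by
        rw [integral_const_mul]
        ring
end

section
/- Let n ≥ 1, m ∈ ℕ, and define the viscous stress tensor 𝒵_m(F,Q) = [sym(QF^{-1})]^{2m+1} F^{-1,T} for invertible real n×n matrices F and arbitrary real n×n matrices Q. Then 𝒵_m satisfies the three principles (1.5): (i) balance of angular momentum: the matrix F^{-1}𝒵_m(F,Q) is symmetric; (ii) frame invariance: for every R ∈ SO(n) and every skew-symmetric real n×n matrix K, 𝒵_m(RF, RKF + RQ) = R·𝒵_m(F,Q); (iii) Clausius–Duhem inequality: ⟨𝒵_m(F,Q) : Q⟩ = tr( [sym(QF^{-1})]^{2m+2} ) ≥ 0. -/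
open Matrix

/-- The viscous stress tensor `𝒵_m(F,Q) = [sym(QF⁻¹)]^{2m+1} F^{-1,T}`. -/
noncomputable def Zm {n : ℕ} (m : ℕ) (F Q : Matrix (Fin n) (Fin n) ℝ) :
    Matrix (Fin n) (Fin n) ℝ :=
  (msym (Q * F⁻¹)) ^ (2 * m + 1) * F⁻¹ᵀ

theorem msym_transpose {n : ℕ} (A : Matrix (Fin n) (Fin n) ℝ) : (msym A)ᵀ = msym A := by
  simp [msym, add_comm]

theorem msym_pow_transpose {n : ℕ} (A : Matrix (Fin n) (Fin n) ℝ) (k : ℕ) :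
    (msym A ^ k)ᵀ = msym A ^ k := by
  rw [transpose_pow, msym_transpose]

theorem msym_add_skew {n : ℕ} {K : Matrix (Fin n) (Fin n) ℝ} (hK : Kᵀ = -K)
    (A : Matrix (Fin n) (Fin n) ℝ) : msym (K + A) = msym A := by
  simp only [msym, transpose_add, hK]
  congr 1
  abel

theorem msym_conj {n : ℕ} (R A : Matrix (Fin n) (Fin n) ℝ) :
    msym (R * A * Rᵀ) = R * msym A * Rᵀ := by
  simp [msym, mul_add, add_mul, mul_assoc]

theorem conj_pow_mul {n : ℕ} {R : Matrix (Fin n) (Fin n) ℝ} (hR : Rᵀ * R = 1)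
    (S : Matrix (Fin n) (Fin n) ℝ) (k : ℕ) : (R * S * Rᵀ) ^ k * R = R * S ^ k := by
  induction k with
  | zero => simp
  | succ k ih =>
    calc (R * S * Rᵀ) ^ (k + 1) * R = (R * S * Rᵀ) ^ k * R * S * (Rᵀ * R) := by
          simp only [pow_succ, mul_assoc]
      _ = R * S ^ (k + 1) := by rw [hR, ih, mul_one, pow_succ, mul_assoc]

/-- A symmetric matrix is orthogonal to the skew part of any matrix. -/
theorem trace_mul_msym {n : ℕ} {S : Matrix (Fin n) (Fin n) ℝ} (hS : Sᵀ = S)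
    (A : Matrix (Fin n) (Fin n) ℝ) : (S * msym A).trace = (S * A).trace := by
  have h : (S * Aᵀ).trace = (S * A).trace := by
    rw [← trace_transpose, transpose_mul, transpose_transpose, hS, trace_mul_comm]
  simp only [msym, mul_smul_comm, mul_add, trace_smul, trace_add, h, smul_eq_mul]
  ring

theorem trace_transpose_mul_self_nonneg {n : ℕ} (A : Matrix (Fin n) (Fin n) ℝ) :
    0 ≤ (Aᵀ * A).trace := by
  simpa using (posSemidef_conjTranspose_mul_self A).trace_nonneg

theorem stmt_11 {n : ℕ} (hn : 1 ≤ n) (m : ℕ)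
    (F Q : Matrix (Fin n) (Fin n) ℝ) (hF : IsUnit F.det) :
    -- (i) balance of angular momentum: F⁻¹ 𝒵_m(F,Q) is symmetric
    ((F⁻¹ * Zm m F Q)ᵀ = F⁻¹ * Zm m F Q) ∧
    -- (ii) frame invariance
    (∀ R K : Matrix (Fin n) (Fin n) ℝ, Rᵀ * R = 1 → R.det = 1 → Kᵀ = -K →
      Zm m (R * F) (R * K * F + R * Q) = R * Zm m F Q) ∧
    -- (iii) Clausius–Duhem inequality
    (mip (Zm m F Q) Q = ((msym (Q * F⁻¹)) ^ (2 * m + 2)).trace ∧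
      0 ≤ ((msym (Q * F⁻¹)) ^ (2 * m + 2)).trace) := by
  refine ⟨?_, ?_, ?_, ?_⟩
  · simp only [Zm, transpose_mul, transpose_transpose, msym_pow_transpose, mul_assoc]
  · intro R K hR _ hK
    have hRinv : R⁻¹ = Rᵀ := inv_eq_left_inv hR
    have hconj : (R * K * F + R * Q) * (R * F)⁻¹ = R * (K + Q * F⁻¹) * Rᵀ := by
      rw [Matrix.mul_inv_rev, hRinv, ← mul_assoc, add_mul, mul_nonsing_inv_cancel_right _ _ hF,
        mul_assoc R Q, ← mul_add]
    rw [Zm, hconj, msym_conj, msym_add_skew hK, Matrix.mul_inv_rev, hRinv, transpose_mul,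
      transpose_transpose, ← mul_assoc, conj_pow_mul hR, mul_assoc, Zm]
  · rw [mip, Zm, transpose_mul, transpose_transpose, msym_pow_transpose, mul_assoc,
      trace_mul_comm, mul_assoc, ← trace_mul_msym (msym_pow_transpose _ _), ← pow_succ]
  · have h := trace_transpose_mul_self_nonneg (msym (Q * F⁻¹) ^ (m + 1))
    rwa [msym_pow_transpose, ← pow_add, show m + 1 + (m + 1) = 2 * m + 2 by ring] at h
end
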